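/- Suppose g : ℕ → {0,…,k-1} is diagonally non-recursive relative to f, where k = 2^d, and identify values of g with binary strings of length d. Then g computes a 2-bounded diagonally non-recursive function relative to f, assuming the Π₂ least element principle: among all i ≤ d such that for every i-tuple n⃗ there is a (d−i)-tuple m⃗ with h(i+j, n⃗⌢m⃗) = Φ^f_{m_j}(m_j) for all j < d−i, there is a least one (where h(j, n⃗) is the j-th bit of g(ℓ(n⃗)) and ℓ(n⃗) is an index of a program computing the constant function x ↦ ⟨b(n₀),…,b(n_{d−1})⟩ with b(n) the sign bit of Φ_n^f(n)). Conclusion: there is a total function p ≤_T f ⊕ g with p(x) ∈ {0,1} and p(x) ≠ Φ_x^f(x) whenever Φ_x^f(x) converges. -/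

import Mathlib

namespace Paper

/-- Codes for oracle partial recursive functions (Kleene-style, with an `oracle` query). -/
inductive OCode : Type
  | zero : OCode
  | succ : OCode
  | left : OCode
  | right : OCode
  | oracle : OCode
  | pair : OCode → OCode → OCode
  | comp : OCode → OCode → OCode
  | prec : OCode → OCode → OCode
  | rfind' : OCode → OCode

/-- Evaluation of an oracle code relative to a (partial) oracle `o`. -/
def oeval (o : ℕ →. ℕ) : OCode → ℕ →. ℕ
  | .zero => pure 0
  | .succ => Nat.succ
  | .left => ↑fun n : ℕ => n.unpair.1
  | .right => ↑fun n : ℕ => n.unpair.2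
  | .oracle => o
  | .pair cf cg => fun n => Nat.pair <$> oeval o cf n <*> oeval o cg n
  | .comp cf cg => fun n => oeval o cg n >>= oeval o cf
  | .prec cf cg =>
    Nat.unpaired fun a n =>
      n.rec (oeval o cf a) fun y IH => do
        let i ← IH
        oeval o cg (Nat.pair a (Nat.pair y i))
  | .rfind' cf =>
    Nat.unpaired fun a m =>
      (Nat.rfind fun n => (fun m => m = 0) <$> oeval o cf (Nat.pair a (n + m))).map (· + m)

/-- Decoding of natural numbers into oracle codes (with fuel). -/
def ofNatAux : ℕ → ℕ → OCode
  | 0, _ => .zero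
  | _ + 1, 0 => .zero
  | _ + 1, 1 => .succ
  | _ + 1, 2 => .left
  | _ + 1, 3 => .right
  | _ + 1, 4 => .oracle
  | fuel + 1, n + 5 =>
    let m := n.div2.div2
    match n.bodd, n.div2.bodd with
    | false, false => .pair (ofNatAux fuel m.unpair.1) (ofNatAux fuel m.unpair.2)
    | false, true => .comp (ofNatAux fuel m.unpair.1) (ofNatAux fuel m.unpair.2)
    | true, false => .prec (ofNatAux fuel m.unpair.1) (ofNatAux fuel m.unpair.2)
    | true, true => .rfind' (ofNatAux fuel m)

/-- The `e`-th oracle code. -/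
def ofNatOC (e : ℕ) : OCode := ofNatAux (e + 1) e

/-- `Phi o e` is Φ_e^o, the `e`-th partial function computed with oracle `o`. -/
def Phi (o : ℕ →. ℕ) (e : ℕ) : ℕ →. ℕ := oeval o (ofNatOC e)

/-- A total function regarded as a (partial) oracle. -/
def tot (f : ℕ → ℕ) : ℕ →. ℕ := fun n => Part.some (f n)

/-- The join `f ⊕ g` of two partial oracles. -/
def pjoin (f g : ℕ →. ℕ) : ℕ →. ℕ := fun n => if n % 2 = 0 then f (n / 2) else g (n / 2)

end Paper

namespace Paper

open Nat.Partrec (Code)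
open Filter Encodable

section Evaluation

variable (o : ℕ →. ℕ) (cf cg : OCode) (df dg : Code) (a n k : ℕ)

theorem oeval_pair : oeval o (.pair cf cg) n =
    (oeval o cf n).bind fun x => (oeval o cg n).map (Nat.pair x) := by
  simp [oeval, Seq.seq, Part.bind_map]

theorem oeval_comp : oeval o (.comp cf cg) n = (oeval o cg n).bind fun x => oeval o cf x := rfl

theorem oeval_left : oeval o .left n = Part.some n.unpair.1 := rfl

theorem oeval_right : oeval o .right n = Part.some n.unpair.2 := rfl

theorem oeval_prec_zero : oeval o (.prec cf cg) (Nat.pair a 0) = oeval o cf a := by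
  simp [oeval]

theorem oeval_prec_succ : oeval o (.prec cf cg) (Nat.pair a (k + 1)) =
    (oeval o (.prec cf cg) (Nat.pair a k)).bind
      fun i => oeval o cg (Nat.pair a (Nat.pair k i)) := by
  simp [oeval]

theorem oeval_rfind' : oeval o (.rfind' cf) (Nat.pair a k) = (Nat.rfind fun n =>
    (oeval o cf (Nat.pair a (n + k))).map fun m => decide (m = 0)).map (· + k) := by
  simp [oeval]

theorem eval_pair : (Code.pair df dg).eval n =
    (df.eval n).bind fun x => (dg.eval n).map (Nat.pair x) := by
  simp [Code.eval, Seq.seq, Part.bind_map]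

theorem eval_comp : (Code.comp df dg).eval n = (dg.eval n).bind fun x => df.eval x := rfl

theorem eval_left : Code.left.eval n = Part.some n.unpair.1 := rfl

theorem eval_right : Code.right.eval n = Part.some n.unpair.2 := rfl

theorem eval_rfind' : (Code.rfind' df).eval (Nat.pair a k) = (Nat.rfind fun n =>
    (df.eval (Nat.pair a (n + k))).map fun m => decide (m = 0)).map (· + k) := by
  simp [Code.eval]

end Evaluation

/-- If the partial oracles `O i` eventually answer every query that `o` answers, in the same way,
then every convergent computation from `o` is eventually a convergent computation from `O i`. -/
theorem eventually_mem_oeval {ι : Type*} {l : Filter ι} {o : ℕ →. ℕ} {O : ι → ℕ →. ℕ}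
    (h : ∀ n y, y ∈ o n → ∀ᶠ i in l, y ∈ O i n) (c : OCode) :
    ∀ n y, y ∈ oeval o c n → ∀ᶠ i in l, y ∈ oeval (O i) c n := by
  induction c with
  | zero | succ | left | right => exact fun n y hy => Filter.Eventually.of_forall fun _ => hy
  | oracle => exact h
  | pair cf cg hf hg =>
    intro n y hy
    simp only [oeval, Seq.seq, Part.map_eq_map, Part.mem_bind_iff, Part.mem_map_iff,
      exists_exists_and_eq_and] at hy ⊢
    obtain ⟨a, ha, b, hb, rfl⟩ := hy
    filter_upwards [hf n a ha, hg n b hb] with i h1 h2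
    exact ⟨a, h1, b, h2, rfl⟩
  | comp cf cg hf hg =>
    intro n y hy
    obtain ⟨a, ha, hb⟩ := Part.mem_bind_iff.1 hy
    filter_upwards [hg n a ha, hf a y hb] with i h1 h2
    exact Part.mem_bind_iff.2 ⟨a, h1, h2⟩
  | prec cf cg hf hg =>
    intro n y hy
    simp only [oeval, Nat.unpaired] at hy ⊢
    generalize n.unpair.2 = k at hy ⊢
    induction k generalizing y with
    | zero => exact hf _ y hy
    | succ k ih =>
      obtain ⟨a, ha, hb⟩ := Part.mem_bind_iff.1 hy
      filter_upwards [ih a ha, hg _ y hb] with i h1 h2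
      exact Part.mem_bind_iff.2 ⟨a, h1, h2⟩
  | rfind' cf hf =>
    intro n y hy
    obtain ⟨a, ha, rfl⟩ := (Part.mem_map_iff _).1 hy
    obtain ⟨hb, hlt⟩ := Nat.mem_rfind.1 ha
    obtain ⟨b, hb, hb0⟩ := (Part.mem_map_iff _).1 hb
    have hall : ∀ᶠ i in l, ∀ m ∈ Finset.range a, ∃ b ∈ oeval (O i) cf
        (Nat.pair n.unpair.1 (m + n.unpair.2)), decide (b = 0) = false := by
      refine (Filter.eventually_all_finset _).2 fun m hm => ?_
      obtain ⟨b', hb', hb0'⟩ := (Part.mem_map_iff _).1 (hlt (Finset.mem_range.1 hm))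
      filter_upwards [hf _ b' hb'] with i h1 using ⟨b', h1, hb0'⟩
    filter_upwards [hf _ b hb, hall] with i h1 h2
    exact (Part.mem_map_iff _).2 ⟨a, Nat.mem_rfind.2 ⟨(Part.mem_map_iff _).2 ⟨b, h1, hb0⟩,
      fun hm => (Part.mem_map_iff _).2 (h2 _ (Finset.mem_range.2 hm))⟩, rfl⟩

theorem oeval_mono {o o' : ℕ →. ℕ} (h : ∀ n y, y ∈ o n → y ∈ o' n) (c : OCode) (n y : ℕ)
    (hy : y ∈ oeval o c n) : y ∈ oeval o' c n :=
  Filter.eventually_pure.1 <| eventually_mem_oeval (l := pure ()) (O := fun _ => o')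
    (fun n y hy => Filter.eventually_pure.2 (h n y hy)) c n y hy

/-- Ordinary codes, viewed as oracle codes which never query the oracle. -/
def ofCode : Code → OCode
  | .zero => .zero
  | .succ => .succ
  | .left => .left
  | .right => .right
  | .pair cf cg => .pair (ofCode cf) (ofCode cg)
  | .comp cf cg => .comp (ofCode cf) (ofCode cg)
  | .prec cf cg => .prec (ofCode cf) (ofCode cg)
  | .rfind' cf => .rfind' (ofCode cf)

theorem oeval_ofCode (o : ℕ →. ℕ) (c : Code) : oeval o (ofCode c) = c.eval := by
  induction c with
  | zero | succ | left | right => rfl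
  | pair _ _ hf hg | comp _ _ hf hg | prec _ _ hf hg =>
    simp only [ofCode, oeval, Code.eval, hf, hg]; rfl
  | rfind' _ hf => simp only [ofCode, oeval, Code.eval, hf]; rfl

theorem exists_ocode_of_primrec {φ : ℕ → ℕ} (hφ : Primrec φ) :
    ∃ c, ∀ o n, oeval o c n = Part.some (φ n) := by
  obtain ⟨c, hc⟩ := Code.exists_code.1 (Partrec.nat_iff.1 hφ.to_comp)
  exact ⟨ofCode c, fun o n => by rw [oeval_ofCode, hc]; rfl⟩

/-- The code `relCode q c` evaluates `c` at `n` on input `⟨a, n⟩`, answering the oracle query `m`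
by the value of `q` at `⟨a, m⟩`. -/
def relCode (q : Code) : OCode → Code
  | .zero => .zero
  | .succ => .comp .succ .right
  | .left => .comp .left .right
  | .right => .comp .right .right
  | .oracle => q
  | .pair cf cg => .pair (relCode q cf) (relCode q cg)
  | .comp cf cg => .comp (relCode q cf) (.pair .left (relCode q cg))
  | .prec cf cg =>
    .comp (.prec (relCode q cf)
        (.comp (relCode q cg)
          (.pair (.comp .left .left) (.pair (.comp .right .left) .right))))
      (.pair (.pair .left (.comp .left .right)) (.comp .right .right))
  | .rfind' cf =>
    .comp (.rfind' (.comp (relCode q cf)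
        (.pair (.comp .left .left) (.pair (.comp .right .left) .right))))
      (.pair (.pair .left (.comp .left .right)) (.comp .right .right))

theorem eval_relCode {q : Code} {o : ℕ →. ℕ} {a : ℕ} (h : ∀ m, q.eval (Nat.pair a m) = o m)
    (c : OCode) (n : ℕ) : (relCode q c).eval (Nat.pair a n) = oeval o c n := by
  induction c generalizing n with
  | zero => rfl
  | oracle => exact h n
  | succ | left | right =>
    rw [relCode, eval_comp, eval_right, Part.bind_some, Nat.unpair_pair]; rfl
  | pair cf cg hf hg => simp only [relCode, eval_pair, oeval_pair, hf, hg]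
  | comp cf cg hf hg =>
    simp [relCode, eval_comp, eval_pair, eval_left, oeval_comp, hg, Part.bind_map, hf]
  | prec cf cg hf hg =>
    obtain ⟨m, k, rfl⟩ : ∃ m k, n = Nat.pair m k := ⟨_, _, (Nat.pair_unpair n).symm⟩
    rw [relCode, eval_comp]
    simp only [eval_pair, eval_comp, eval_left, eval_right, Part.bind_some, Part.map_some,
      Nat.unpair_pair]
    induction k with
    | zero => rw [Code.eval_prec_zero, oeval_prec_zero, hf]
    | succ k ih =>
      rw [Code.eval_prec_succ, oeval_prec_succ, ← ih]
      simp [eval_pair, eval_comp, eval_left, eval_right, hg]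
  | rfind' cf hf =>
    obtain ⟨m, k, rfl⟩ : ∃ m k, n = Nat.pair m k := ⟨_, _, (Nat.pair_unpair n).symm⟩
    simp [relCode, eval_comp, eval_pair, eval_left, eval_right, eval_rfind', oeval_rfind', hf]

theorem ofNatAux_eq_ofNatOC : ∀ k n, n < k → ofNatAux k n = ofNatOC n := by
  suffices h : ∀ n k l, n < k → n < l → ofNatAux k n = ofNatAux l n from
    fun k n hk => h n k (n + 1) hk n.lt_succ_self
  intro n
  induction n using Nat.strong_induction_on with
  | _ n ih =>
    rintro (_ | k) (_ | l) hk hl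
    · omega
    · omega
    · omega
    match n, ih, hk, hl with
    | 0, _, _, _ | 1, _, _, _ | 2, _, _, _ | 3, _, _, _ | 4, _, _, _ => rfl
    | n + 5, ih, hk, hl =>
      have hm : n.div2.div2 ≤ n := by
        rw [Nat.div2_val, Nat.div2_val]; omega
      have h1 := (Nat.unpair_left_le n.div2.div2).trans hm
      have h2 := (Nat.unpair_right_le n.div2.div2).trans hm
      simp only [ofNatAux]
      rw [ih _ (by omega) k l (by omega) (by omega), ih _ (by omega) k l (by omega) (by omega),
        ih n.div2.div2 (by omega) k l (by omega) (by omega)]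

theorem ofNatOC_add_five (n : ℕ) : ofNatOC (n + 5) =
    let m := n.div2.div2
    match n.bodd, n.div2.bodd with
    | false, false => .pair (ofNatOC m.unpair.1) (ofNatOC m.unpair.2)
    | false, true => .comp (ofNatOC m.unpair.1) (ofNatOC m.unpair.2)
    | true, false => .prec (ofNatOC m.unpair.1) (ofNatOC m.unpair.2)
    | true, true => .rfind' (ofNatOC m) := by
  have hm : n.div2.div2 ≤ n := by
    rw [Nat.div2_val, Nat.div2_val]; omega
  have h1 := (Nat.unpair_left_le n.div2.div2).trans hm
  have h2 := (Nat.unpair_right_le n.div2.div2).trans hm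
  rw [ofNatOC, ofNatAux]
  simp only
  rw [ofNatAux_eq_ofNatOC _ _ (by omega), ofNatAux_eq_ofNatOC _ _ (by omega),
    ofNatAux_eq_ofNatOC _ n.div2.div2 (by omega)]

/-- An index for each oracle code. -/
def index : OCode → ℕ
  | .zero => 0
  | .succ => 1
  | .left => 2
  | .right => 3
  | .oracle => 4
  | .pair cf cg => 2 * (2 * Nat.pair (index cf) (index cg)) + 5
  | .comp cf cg => 2 * (2 * Nat.pair (index cf) (index cg) + 1) + 5
  | .prec cf cg => 2 * (2 * Nat.pair (index cf) (index cg)) + 1 + 5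
  | .rfind' cf => 2 * (2 * index cf + 1) + 1 + 5

theorem ofNatOC_index (c : OCode) : ofNatOC (index c) = c := by
  induction c with
  | zero | succ | left | right | oracle => rfl
  | pair _ _ hf hg | comp _ _ hf hg | prec _ _ hf hg =>
    simp [index, ofNatOC_add_five, Nat.div2_val, hf, hg]
  | rfind' _ hf =>
    simp [index, ofNatOC_add_five, Nat.div2_val, hf]

theorem Phi_index (o : ℕ →. ℕ) (c : OCode) (n : ℕ) : Phi o (index c) n = oeval o c n := by
  rw [Phi, ofNatOC_index]

/-- One step of the course-of-values recursion computing `relCode q (ofNatOC e)`: the list `L`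
holds the values at the smaller arguments. -/
def relCodeStep (q : Code) (L : List Code) : Code :=
  let n := L.length - 5
  let m := n.div2.div2
  let a := L.getI m.unpair.1
  let b := L.getI m.unpair.2
  if L.length = 0 then relCode q .zero
  else if L.length = 1 then relCode q .succ
  else if L.length = 2 then relCode q .left
  else if L.length = 3 then relCode q .right
  else if L.length = 4 then relCode q .oracle
  else bif n.bodd then
      bif n.div2.bodd then
        .comp (.rfind' (.comp (L.getI m)
          (.pair (.comp .left .left) (.pair (.comp .right .left) .right))))
          (.pair (.pair .left (.comp .left .right)) (.comp .right .right))
      else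
        .comp (.prec a (.comp b (.pair (.comp .left .left) (.pair (.comp .right .left) .right))))
          (.pair (.pair .left (.comp .left .right)) (.comp .right .right))
    else
      bif n.div2.bodd then .comp a (.pair .left b) else .pair a b

theorem primrec_relCodeStep (q : Code) : Primrec (relCodeStep q) := by
  have hn : Primrec fun L : List Code => L.length - 5 :=
    Primrec.nat_sub.comp Primrec.list_length (Primrec.const 5)
  have hm : Primrec fun L : List Code => (L.length - 5).div2.div2 :=
    Primrec.nat_div2.comp (Primrec.nat_div2.comp hn)
  have hlen (i : ℕ) : PrimrecPred fun L : List Code => L.length = i :=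
    Primrec.eq.comp Primrec.list_length (Primrec.const i)
  have hget {f : List Code → ℕ} (hf : Primrec f) : Primrec fun L : List Code => L.getI (f L) :=
    Primrec.list_getI.comp Primrec.id hf
  have ha := hget (Primrec.fst.comp (Primrec.unpair.comp hm))
  have hb := hget (Primrec.snd.comp (Primrec.unpair.comp hm))
  have k (d : Code) : Primrec fun _ : List Code => d := Primrec.const d
  have hodd := Primrec.nat_bodd.comp (Primrec.nat_div2.comp hn)
  exact Primrec.ite (hlen 0) (k _) <| Primrec.ite (hlen 1) (k _) <|
    Primrec.ite (hlen 2) (k _) <| Primrec.ite (hlen 3) (k _) <|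
    Primrec.ite (hlen 4) (k _) <| Primrec.cond (Primrec.nat_bodd.comp hn)
      (Primrec.cond hodd
        (Code.primrec₂_comp.comp
          (Code.primrec_rfind'.comp (Code.primrec₂_comp.comp (hget hm) (k _))) (k _))
        (Code.primrec₂_comp.comp
          (Code.primrec₂_prec.comp ha (Code.primrec₂_comp.comp hb (k _))) (k _)))
      (Primrec.cond hodd
        (Code.primrec₂_comp.comp ha (Code.primrec₂_pair.comp (k _) hb))
        (Code.primrec₂_pair.comp ha hb))

theorem relCodeStep_map_range (q : Code) (n : ℕ) :
    relCodeStep q ((List.range n).map fun e => relCode q (ofNatOC e)) =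
      relCode q (ofNatOC n) := by
  match n with
  | 0 | 1 | 2 | 3 | 4 => rfl
  | n + 5 =>
    have hm : n.div2.div2 ≤ n := by
      rw [Nat.div2_val, Nat.div2_val]; omega
    have h1 := (Nat.unpair_left_le n.div2.div2).trans hm
    have h2 := (Nat.unpair_right_le n.div2.div2).trans hm
    have hget (i : ℕ) (hi : i < n + 5) : ((List.range (n + 5)).map
        fun e => relCode q (ofNatOC e)).getI i = relCode q (ofNatOC i) := by
      rw [List.getI_eq_getElem _ (by simpa using hi)]; simp
    rw [ofNatOC_add_five]
    simp only [relCodeStep, List.length_map, List.length_range, Nat.add_sub_cancel]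
    rw [hget _ (by omega), hget _ (by omega), hget _ (by omega)]
    cases n.bodd <;> cases n.div2.bodd <;> simp [relCode]

theorem primrec_relCode (q : Code) : Primrec fun e => relCode q (ofNatOC e) :=
  (Primrec.nat_strong_rec (fun (_ : Unit) e => relCode q (ofNatOC e))
    (Primrec.option_some.comp ((primrec_relCodeStep q).comp Primrec.snd)).to₂
    fun _ n => congrArg some (relCodeStep_map_range q n)).comp (Primrec.const ()) Primrec.id

/-- The list of the first `t` values of `s`. -/
def initSeg (s : ℕ → ℕ) (t : ℕ) : List ℕ := (List.range t).map s

theorem length_initSeg (s : ℕ → ℕ) (t : ℕ) : (initSeg s t).length = t := by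
  simp [initSeg]

theorem getElem?_initSeg {s : ℕ → ℕ} {t n : ℕ} (h : n < t) : (initSeg s t)[n]? = some (s n) := by
  simp [initSeg, h]

theorem mem_getElem?_initSeg {s : ℕ → ℕ} {t n y : ℕ} (h : (initSeg s t)[n]? = some y) :
    s n = y := by
  rw [initSeg, List.getElem?_map, Option.map_eq_some_iff] at h
  obtain ⟨a, ha, rfl⟩ := h
  obtain ⟨hn, rfl⟩ := List.getElem?_eq_some_iff.1 ha
  simp

theorem map_initSeg (φ s : ℕ → ℕ) (t : ℕ) : (initSeg s t).map φ = initSeg (fun n => φ (s n)) t := by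
  simp [initSeg]

theorem initSeg_getI {s : ℕ → ℕ} {t u : ℕ} (h : u ≤ t) :
    initSeg (initSeg s t).getI u = initSeg s u := by
  refine List.map_congr_left fun n hn => ?_
  have hn : n < t := (List.mem_range.1 hn).trans_le h
  rw [List.getI_eq_getElem _ (by rwa [length_initSeg])]
  simp [initSeg]

theorem exists_lookup_code : ∃ q : Code, ∀ (L : List ℕ) (n : ℕ),
    q.eval (Nat.pair (Encodable.encode L) n) = (L[n]? : Part ℕ) := by
  have h : Partrec fun n : ℕ =>
      ((Denumerable.ofNat (List ℕ) n.unpair.1)[n.unpair.2]? : Part ℕ) :=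
    Computable.ofOption (Primrec.list_getElem?.comp
      ((Primrec.ofNat (List ℕ)).comp (Primrec.fst.comp Primrec.unpair))
      (Primrec.snd.comp Primrec.unpair)).to_comp
  obtain ⟨q, hq⟩ := Code.exists_code.1 (Partrec.nat_iff.1 h)
  exact ⟨q, fun L n => by rw [hq]; simp⟩

/-- The diagonal partial function `e ↦ Φ_e^f(e)` is approximated, uniformly in `f`, by a primitive
recursive function of the initial segments of `f`. -/
theorem exists_approximation : ∃ E : List ℕ → ℕ → Option ℕ, Primrec₂ E ∧ ∀ f : ℕ → ℕ,
    (∀ t e y, E (initSeg f t) e = some y → y ∈ Phi (tot f) e e) ∧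
    ∀ e y, y ∈ Phi (tot f) e e → ∀ᶠ t in atTop, E (initSeg f t) e = some y := by
  obtain ⟨q, hq⟩ := exists_lookup_code
  let stage (k e : ℕ) (L : List ℕ) : Option ℕ :=
    Code.evaln k (relCode q (ofNatOC e)) (Nat.pair (Encodable.encode L) e)
  have hsound (f : ℕ → ℕ) (k e u y : ℕ) (h : stage k e (initSeg f u) = some y) :
      y ∈ Phi (tot f) e e := by
    have := Code.evaln_sound h
    rw [eval_relCode (o := fun n => ((initSeg f u)[n]? : Part ℕ)) (hq _)] at this
    refine oeval_mono (fun n z hz => ?_) _ _ _ this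
    rw [← mem_getElem?_initSeg (Part.mem_ofOption.1 hz)]
    exact Part.mem_some _
  refine ⟨fun L e => ((List.range (L.length + 1)).filterMap
    fun u => stage L.length e (initSeg L.getI u)).head?, ?_, fun f => ⟨?_, ?_⟩⟩
  · have hseg : Primrec₂ fun (L : List ℕ) u => initSeg L.getI u :=
      Primrec.list_map (Primrec.list_range.comp Primrec.snd)
        (Primrec.list_getI.comp (Primrec.fst.comp Primrec.fst) Primrec.snd).to₂
    have hstage : Primrec fun x : (ℕ × ℕ) × List ℕ => stage x.1.1 x.1.2 x.2 :=
      Code.primrec_evaln.comp (Primrec.pair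
        (Primrec.pair (Primrec.fst.comp Primrec.fst)
          ((primrec_relCode q).comp (Primrec.snd.comp Primrec.fst)))
        (Primrec₂.natPair.comp (Primrec.encode.comp Primrec.snd)
          (Primrec.snd.comp Primrec.fst)))
    exact Primrec.list_head?.comp (Primrec.listFilterMap
      (Primrec.list_range.comp (Primrec.succ.comp (Primrec.list_length.comp Primrec.fst)))
      (hstage.comp (Primrec.pair
        (Primrec.pair (Primrec.list_length.comp (Primrec.fst.comp Primrec.fst))
          (Primrec.snd.comp Primrec.fst))
        (hseg.comp (Primrec.fst.comp Primrec.fst) Primrec.snd))).to₂)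
  · intro t e y h
    obtain ⟨u, hu, h⟩ := List.mem_filterMap.1 (List.mem_of_mem_head? h)
    rw [List.mem_range, length_initSeg] at hu
    rw [initSeg_getI (by omega)] at h
    exact hsound f _ _ _ _ h
  · intro e y h
    obtain ⟨u, hu⟩ := (eventually_mem_oeval (l := atTop)
      (O := fun t n => ((initSeg f t)[n]? : Part ℕ)) (fun n z hz => by
        filter_upwards [eventually_gt_atTop n] with t ht
        rw [getElem?_initSeg ht]
        exact hz) _ _ _ h).exists
    rw [← eval_relCode (hq _)] at hu
    obtain ⟨k, hk⟩ := Code.evaln_complete.1 hu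
    filter_upwards [eventually_ge_atTop k, eventually_ge_atTop u] with t hkt hut
    have hmem : y ∈ (List.range ((initSeg f t).length + 1)).filterMap
        fun u => stage (initSeg f t).length e (initSeg (initSeg f t).getI u) := by
      refine List.mem_filterMap.2 ⟨u, ?_, ?_⟩
      · rw [List.mem_range, length_initSeg]; omega
      · rw [initSeg_getI hut, length_initSeg]
        exact Code.evaln_mono hkt hk
    cases hhead : List.head? _ with
    | none => simp [List.head?_eq_none_iff.1 hhead] at hmem
    | some z =>
      obtain ⟨v, hv, h'⟩ := List.mem_filterMap.1 (List.mem_of_mem_head? hhead)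
      rw [List.mem_range, length_initSeg] at hv
      rw [initSeg_getI (by omega)] at h'
      exact congrArg some (Part.mem_unique (hsound f _ _ _ _ h') h)

theorem exists_initSeg_code {o : ℕ →. ℕ} {s : ℕ → ℕ} {c : OCode}
    (hc : ∀ n, oeval o c n = Part.some (s n)) :
    ∃ c', ∀ x t, oeval o c' (Nat.pair x t) = Part.some (Nat.pair x (encode (initSeg s t))) := by
  have happ : Primrec fun v : ℕ =>
      encode (Denumerable.ofNat (List ℕ) v.unpair.1 ++ [v.unpair.2]) :=
    Primrec.encode.comp (Primrec.list_concat.comp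
      ((Primrec.ofNat (List ℕ)).comp (Primrec.fst.comp Primrec.unpair))
      (Primrec.snd.comp Primrec.unpair))
  obtain ⟨a, ha⟩ := exists_ocode_of_primrec happ
  refine ⟨.pair .left (.prec .zero (.comp a (.pair (.comp .right .right)
    (.comp c (.comp .left .right))))), fun x t => ?_⟩
  rw [oeval_pair, oeval_left]
  suffices h : oeval o (.prec .zero (.comp a (.pair (.comp .right .right)
      (.comp c (.comp .left .right))))) (Nat.pair x t) = Part.some (encode (initSeg s t)) by
    simp [h]
  induction t with
  | zero => rw [oeval_prec_zero]; rfl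
  | succ t ih =>
    rw [oeval_prec_succ, ih]
    simp [oeval_comp, oeval_pair, oeval_left, oeval_right, hc, ha, initSeg, List.range_succ]

/-- Unbounded search, over the initial segments of a function computable from `o`, for a value of
a primitive recursive partial function. -/
theorem exists_search_code {o : ℕ →. ℕ} {s : ℕ → ℕ} {c : OCode}
    (hc : ∀ n, oeval o c n = Part.some (s n)) {C : ℕ → List ℕ → Option ℕ} (hC : Primrec₂ C) :
    ∃ c', ∀ x, (∀ y, y ∈ oeval o c' x → ∃ t, C x (initSeg s t) = some y) ∧
      ∀ t y, C x (initSeg s t) = some y → (oeval o c' x).Dom := by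
  obtain ⟨a, ha⟩ := exists_initSeg_code hc
  have hC' : Primrec fun v : ℕ => C v.unpair.1 (Denumerable.ofNat (List ℕ) v.unpair.2) :=
    hC.comp (Primrec.fst.comp Primrec.unpair)
      ((Primrec.ofNat (List ℕ)).comp (Primrec.snd.comp Primrec.unpair))
  obtain ⟨test, htest⟩ := exists_ocode_of_primrec
    (Primrec.cond (Primrec.option_isSome.comp hC') (Primrec.const 0) (Primrec.const 1))
  obtain ⟨val, hval⟩ := exists_ocode_of_primrec (Primrec.option_getD.comp hC' (Primrec.const 0))
  obtain ⟨start, hstart⟩ := exists_ocode_of_primrec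
    (Primrec₂.natPair.comp Primrec.id (Primrec.const 0))
  obtain ⟨i, hi⟩ := exists_ocode_of_primrec Primrec.id
  let search : OCode := .comp (.rfind' (.comp test a)) start
  have hsearch (x : ℕ) : oeval o search x =
      Nat.rfind fun t => Part.some (C x (initSeg s t)).isSome := by
    simp only [search, oeval_comp, hstart, Part.bind_some, id, oeval_rfind', ha, htest,
      Nat.unpair_pair, Denumerable.ofNat_encode, Nat.add_zero, Part.map_some]
    refine (Part.map_id' (fun _ => rfl) _).trans (congrArg _ ?_)
    funext t
    cases (C x (initSeg s t)).isSome <;> rfl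
  refine ⟨.comp val (.comp a (.pair i search)), fun x => ?_⟩
  have heval : oeval o (.comp val (.comp a (.pair i search))) x =
      (Nat.rfind fun t => Part.some (C x (initSeg s t)).isSome).map
        fun t => (C x (initSeg s t)).getD 0 := by
    simp [oeval_comp, oeval_pair, hi, hsearch, ha, hval, Part.bind_map, Part.bind_some_eq_map,
      Part.map_map, Function.comp_def]
  rw [heval]
  refine ⟨fun y hy => ?_, fun t y h => ?_⟩
  · obtain ⟨t, ht, rfl⟩ := (Part.mem_map_iff _).1 hy
    have := Part.mem_some_iff.1 (Nat.rfind_spec ht)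
    obtain ⟨z, hz⟩ := Option.isSome_iff_exists.1 this.symm
    exact ⟨t, by simp [hz]⟩
  · exact Nat.rfind_dom.2 ⟨t, by simp [h], fun _ => trivial⟩

/-- The number whose binary digits are the signs of the values of `b` along a list. -/
def signValue (b : ℕ → Option ℕ) (L : List ℕ) : Option ℕ :=
  L.foldr (fun n r => (b n).bind fun v => r.map fun w => min v 1 + 2 * w) (some 0)

theorem signValue_cons {b : ℕ → Option ℕ} {n v w : ℕ} {L : List ℕ} (hn : b n = some v)
    (hL : signValue b L = some w) : signValue b (n :: L) = some (min v 1 + 2 * w) := by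
  rw [signValue] at hL ⊢
  simp [hn, hL]

theorem eventually_signValue {ι : Type*} {l : Filter ι} {b : ℕ → Option ℕ} {B : ι → ℕ → Option ℕ}
    (h : ∀ n v, b n = some v → ∀ᶠ i in l, B i n = some v) {L : List ℕ} {w : ℕ}
    (hw : signValue b L = some w) : ∀ᶠ i in l, signValue (B i) L = some w := by
  induction L generalizing w with
  | nil => exact Eventually.of_forall fun _ => hw
  | cons n L ih =>
    obtain ⟨v, hv, hw⟩ := Option.bind_eq_some_iff.1 hw
    obtain ⟨r, hr, rfl⟩ := Option.map_eq_some_iff.1 hw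
    filter_upwards [h n v hv, ih hr] with i h1 h2 using signValue_cons h1 h2

theorem signValue_mono {b b' : ℕ → Option ℕ} (h : ∀ n v, b n = some v → b' n = some v)
    {L : List ℕ} {w : ℕ} (hw : signValue b L = some w) : signValue b' L = some w :=
  eventually_pure.1 <| eventually_signValue (l := pure ()) (B := fun _ => b')
    (fun n v hv => eventually_pure.2 (h n v hv)) hw

theorem primrec_signValue {α : Type*} [Primcodable α] {b : α → ℕ → Option ℕ} (hb : Primrec₂ b)
    {L : α → List ℕ} (hL : Primrec L) : Primrec fun a => signValue (b a) (L a) := by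
  refine Primrec.list_foldr (h := fun a x => (b a x.1).bind fun v =>
    x.2.map fun w => min v 1 + 2 * w) hL (Primrec.const _) ?_
  refine Primrec.option_bind
    (g := fun (y : α × ℕ × Option ℕ) v => y.2.2.map fun w => min v 1 + 2 * w)
    (hb.comp Primrec.fst (Primrec.fst.comp Primrec.snd)) ?_
  refine Primrec.option_map (g := fun (z : (α × ℕ × Option ℕ) × ℕ) w => min z.2 1 + 2 * w)
    (Primrec.snd.comp (Primrec.snd.comp Primrec.fst)) ?_
  exact Primrec.nat_add.comp
    (Primrec.nat_min.comp (Primrec.snd.comp Primrec.fst) (Primrec.const 1))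
    (Primrec.nat_mul.comp (Primrec.const 2) Primrec.snd)

/-- A code for the constant function with value `n`. -/
def constCode : ℕ → OCode
  | 0 => .zero
  | n + 1 => .comp .succ (constCode n)

theorem oeval_constCode (o : ℕ →. ℕ) (n x : ℕ) : oeval o (constCode n) x = Part.some n := by
  induction n with
  | zero => rfl
  | succ n ih => rw [constCode, oeval_comp, ih, Part.bind_some]; rfl

theorem primrec_index_comp (c : OCode) {φ : ℕ → OCode} (hφ : Primrec fun n => index (φ n)) :
    Primrec fun n => index (.comp c (φ n)) :=
  Primrec.nat_add.comp (Primrec.nat_mul.comp (Primrec.const 2) (Primrec.nat_add.comp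
    (Primrec.nat_mul.comp (Primrec.const 2) (Primrec₂.natPair.comp (Primrec.const (index c)) hφ))
    (Primrec.const 1))) (Primrec.const 5)

theorem primrec_index_constCode : Primrec fun n => index (constCode n) := by
  have hstep : Primrec fun i => 2 * (2 * Nat.pair (index .succ) i + 1) + 5 :=
    Primrec.nat_add.comp (Primrec.nat_mul.comp (Primrec.const 2) (Primrec.nat_add.comp
      (Primrec.nat_mul.comp (Primrec.const 2)
        (Primrec₂.natPair.comp (Primrec.const (index .succ)) Primrec.id))
      (Primrec.const 1))) (Primrec.const 5)
  refine (Primrec.nat_rec₁ (index .zero) (hstep.comp Primrec.snd).to₂).of_eq fun n => ?_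
  induction n with
  | zero => rfl
  | succ n ih => simp only [constCode, index]; rw [← ih]; rfl

open Classical in
/-- The diagonal partial function `e ↦ Φ_e^f(e)`. -/
noncomputable def diag (f : ℕ → ℕ) (e : ℕ) : Option ℕ := (Phi (tot f) e e).toOption

open Classical in
theorem diag_eq_some {f : ℕ → ℕ} {e y : ℕ} : diag f e = some y ↔ y ∈ Phi (tot f) e e :=
  Part.mem_toOption

/-- A primitive recursive function giving, for each list, an index of a constant function whose
value codes the signs of the diagonal partial function along that list. -/
theorem exists_signValue_index (f : ℕ → ℕ) : ∃ ℓ : List ℕ → ℕ, Primrec ℓ ∧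
    ∀ L v, signValue (diag f) L = some v → ∀ x, Phi (tot f) (ℓ L) x = Part.some v := by
  obtain ⟨E, hE, hf⟩ := exists_approximation
  obtain ⟨hsound, hcomplete⟩ := hf f
  have hC : Primrec₂ fun x σ => signValue (E σ) (Denumerable.ofNat (List ℕ) x) :=
    primrec_signValue (b := fun a : ℕ × List ℕ => E a.2)
      (hE.comp (Primrec.snd.comp Primrec.fst) Primrec.snd).to₂
      ((Primrec.ofNat _).comp Primrec.fst)
  obtain ⟨c, hc⟩ := exists_search_code (o := tot f) (c := .oracle) (fun _ => rfl) hC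
  refine ⟨fun L => index (.comp c (constCode (encode L))),
    (primrec_index_comp c primrec_index_constCode).comp Primrec.encode, fun L v hv x => ?_⟩
  rw [Phi_index, oeval_comp, oeval_constCode, Part.bind_some]
  obtain ⟨hval, hdom⟩ := hc (encode L)
  simp only [Denumerable.ofNat_encode] at hval hdom
  obtain ⟨t, ht⟩ := (eventually_signValue (l := atTop) (B := fun t => E (initSeg f t))
    (fun n v h => hcomplete n v (diag_eq_some.1 h)) hv).exists
  obtain ⟨y, hy⟩ := Part.dom_iff_mem.1 (hdom t v ht)
  obtain ⟨u, hu⟩ := hval y hy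
  have := signValue_mono (fun n v h => diag_eq_some.2 (hsound u n v h)) hu
  obtain rfl : v = y := Option.some_injective _ (hv.symm.trans this)
  exact Part.eq_some_iff.2 hy

theorem exists_oeval_pjoin_eq_pair (f g : ℕ → ℕ) : ∃ c : OCode, ∀ n,
    oeval (pjoin (tot f) (tot g)) c n = Part.some (Nat.pair (f n) (g n)) := by
  obtain ⟨c₀, h₀⟩ := exists_ocode_of_primrec
    (Primrec.nat_mul.comp (Primrec.const 2) Primrec.id)
  obtain ⟨c₁, h₁⟩ := exists_ocode_of_primrec
    (Primrec.succ.comp (Primrec.nat_mul.comp (Primrec.const 2) Primrec.id))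
  refine ⟨.pair (.comp .oracle c₀) (.comp .oracle c₁), fun n => ?_⟩
  have e₀ : oeval (pjoin (tot f) (tot g)) .oracle (2 * n) = Part.some (f n) := by
    simp [oeval, pjoin, tot]
  have e₁ : oeval (pjoin (tot f) (tot g)) .oracle (2 * n + 1) = Part.some (g n) := by
    simp [oeval, pjoin, tot, show (2 * n + 1) % 2 = 1 by omega, show (2 * n + 1) / 2 = n by omega]
  simp [oeval_pair, oeval_comp, h₀, h₁, e₀, e₁]

/-- If `g` is a `2^d`-bounded diagonally non-recursive function relative to `f`, then
some `2`-bounded diagonally non-recursive function relative to `f` is computable from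
`f ⊕ g`. -/
theorem stmt_13 (f g : ℕ → ℕ) (d : ℕ) (hd : 1 ≤ d)
    (hgb : ∀ n : ℕ, g n < 2 ^ d)
    (hgd : ∀ e y : ℕ, Phi (tot f) e e = Part.some y → g e ≠ y) :
    ∃ p : ℕ → ℕ, (∀ x : ℕ, p x ≤ 1) ∧
      (∀ x y : ℕ, Phi (tot f) x x = Part.some y → p x ≠ y) ∧
      ∃ e : ℕ, ∀ x : ℕ, Phi (pjoin (tot f) (tot g)) e x = Part.some (p x) := by
  obtain ⟨ℓ, hℓ, hℓval⟩ := exists_signValue_index f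
  let P (i : ℕ) : Prop := ∀ N : List ℕ, N.length = i →
    ∃ M, signValue (diag f) M = some (g (ℓ (N ++ M)) / 2 ^ i)
  have hPd : P d := fun N _ => ⟨[], by rw [Nat.div_eq_of_lt (hgb _)]; rfl⟩
  have hP0 : ¬ P 0 := fun h => by
    obtain ⟨M, hM⟩ := h [] rfl
    rw [pow_zero, Nat.div_one, List.nil_append] at hM
    exact hgd _ _ (hℓval M _ hM _) rfl
  obtain ⟨i, hi, hPi⟩ : ∃ i, ¬ P i ∧ P (i + 1) := by
    by_contra! h
    exact Nat.rec (motive := fun n => ¬ P n) hP0 h d hPd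
  obtain ⟨N, hN, hNM⟩ : ∃ N : List ℕ, N.length = i ∧
      ∀ M, signValue (diag f) M ≠ some (g (ℓ (N ++ M)) / 2 ^ i) := by
    simpa [P] using hi
  obtain ⟨E, hE, hf⟩ := exists_approximation
  obtain ⟨hsound, hcomplete⟩ := hf f
  let tail (σ : List ℕ) : List ℕ := Denumerable.ofNat (List ℕ) σ.length.unpair.1
  let C (x : ℕ) (σ : List ℕ) : Option ℕ :=
    (σ.map fun n => n.unpair.2)[ℓ (N ++ x :: tail σ)]?.bind fun G =>
      if signValue (E (σ.map fun n => n.unpair.1)) (tail σ) = some (G / 2 ^ (i + 1)) then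
        some (G / 2 ^ i % 2) else none
  have hC : Primrec₂ C := by
    have htail : Primrec tail := (Primrec.ofNat _).comp
      (Primrec.fst.comp (Primrec.unpair.comp Primrec.list_length))
    have hfst : Primrec fun σ : List ℕ => σ.map fun n => n.unpair.1 :=
      Primrec.list_map Primrec.id (Primrec.fst.comp (Primrec.unpair.comp Primrec.snd)).to₂
    have hsnd : Primrec fun σ : List ℕ => σ.map fun n => n.unpair.2 :=
      Primrec.list_map Primrec.id (Primrec.snd.comp (Primrec.unpair.comp Primrec.snd)).to₂
    have hsign : Primrec fun σ : List ℕ =>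
        signValue (E (σ.map fun n => n.unpair.1)) (tail σ) :=
      primrec_signValue (hE.comp (hfst.comp Primrec.fst) Primrec.snd).to₂ htail
    refine Primrec.option_bind (f := fun a : ℕ × List ℕ =>
        (a.2.map fun n => n.unpair.2)[ℓ (N ++ a.1 :: tail a.2)]?)
      (g := fun a G => if signValue (E (a.2.map fun n => n.unpair.1)) (tail a.2) =
        some (G / 2 ^ (i + 1)) then some (G / 2 ^ i % 2) else none) ?_ ?_
    · exact Primrec.list_getElem?.comp (hsnd.comp Primrec.snd)
        (hℓ.comp (Primrec.list_append.comp (Primrec.const N)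
          (Primrec.list_cons.comp Primrec.fst (htail.comp Primrec.snd))))
    · exact Primrec.ite (Primrec.eq.comp (hsign.comp (Primrec.snd.comp Primrec.fst))
          (Primrec.option_some.comp (Primrec.nat_div.comp Primrec.snd (Primrec.const _))))
        (Primrec.option_some.comp (Primrec.nat_mod.comp
          (Primrec.nat_div.comp Primrec.snd (Primrec.const _)) (Primrec.const 2)))
        (Primrec.const none)
  let s (n : ℕ) : ℕ := Nat.pair (f n) (g n)
  have hs₁ (t : ℕ) : ((initSeg s t).map fun n => n.unpair.1) = initSeg f t := by
    simp [map_initSeg, s]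
  have hs₂ (t : ℕ) : ((initSeg s t).map fun n => n.unpair.2) = initSeg g t := by
    simp [map_initSeg, s]
  obtain ⟨cs, hcs⟩ := exists_oeval_pjoin_eq_pair f g
  obtain ⟨c, hc⟩ := exists_search_code (s := s) hcs hC
  have hdom (x : ℕ) : (oeval (pjoin (tot f) (tot g)) c x).Dom := by
    obtain ⟨M, hM⟩ := hPi (N ++ [x]) (by simp [hN])
    rw [List.append_assoc, List.singleton_append] at hM
    obtain ⟨k, hE, hk⟩ := ((tendsto_atTop_mono (Nat.right_le_pair (encode M)) tendsto_id).eventually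
      ((eventually_signValue (l := atTop) (B := fun t => E (initSeg f t))
        (fun n v h => hcomplete n v (diag_eq_some.1 h)) hM).and
      (eventually_gt_atTop (ℓ (N ++ x :: M))))).exists
    refine (hc x).2 (Nat.pair (encode M) k) (g (ℓ (N ++ x :: M)) / 2 ^ i % 2) ?_
    have htail : tail (initSeg s (Nat.pair (encode M) k)) = M := by
      simp [tail, length_initSeg]
    simp only [C, hs₁, hs₂, htail]
    rw [getElem?_initSeg hk, Option.bind_some, if_pos hE]
  have hval (x : ℕ) : ∃ M, signValue (diag f) M = some (g (ℓ (N ++ x :: M)) / 2 ^ (i + 1)) ∧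
      g (ℓ (N ++ x :: M)) / 2 ^ i % 2 = (oeval (pjoin (tot f) (tot g)) c x).get (hdom x) := by
    obtain ⟨t, ht⟩ := (hc x).1 _ (Part.get_mem (hdom x))
    simp only [C, hs₁, hs₂] at ht
    obtain ⟨G, hG, ht⟩ := Option.bind_eq_some_iff.1 ht
    rw [← mem_getElem?_initSeg hG] at ht
    split_ifs at ht with h
    exact ⟨_, signValue_mono (fun n v h => diag_eq_some.2 (hsound t n v h)) h,
      Option.some_injective _ ht⟩
  refine ⟨fun x => (oeval (pjoin (tot f) (tot g)) c x).get (hdom x), fun x => ?_,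
    fun x y hy hp => ?_, index c, fun x => ?_⟩
  · obtain ⟨M, -, h⟩ := hval x
    simp only [← h]
    omega
  · obtain ⟨M, hM, h⟩ := hval x
    refine hNM (x :: M) ((signValue_cons (diag_eq_some.2 (Part.eq_some_iff.1 hy)) hM).trans
      (congrArg some ?_))
    rw [pow_succ, ← Nat.div_div_eq_div_mul]
    simp only [← h] at hp
    omega
  · rw [Phi_index, Part.some_get]

end Paper
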